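/- The semiinfinite order, i.e. the relation on W_ext defined by w ≤^{∞/2} y iff there exists μ ∈ Y with t_μ w, t_μ y ∈ W_ext⁺ and t_μ w ≤ t_μ y, is a partial order (reflexive, antisymmetric, transitive) on W_ext. -/

import Mathlib

open scoped Classical TensorProduct

noncomputable section

namespace SemiInf

/-- The data of a root datum together with its (finite) Weyl group:
finite-rank free `ℤ`-modules `X` and `Y` with a pairing, a finite group `W`
acting on both, a finite set of roots with a subset of positive roots, and a
coroot map. The axioms are collected in `Ctx.IsRootDatum`. -/
structure Ctx where
  X : Type
  Y : Type
  [addX : AddCommGroup X]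
  [addY : AddCommGroup Y]
  W : Type
  [grpW : Group W]
  [finW : Fintype W]
  [actX : DistribMulAction W X]
  [actY : DistribMulAction W Y]
  pair : Y →+ X →+ ℤ
  roots : Finset X
  pos : Finset X
  coroot : X → Y

attribute [instance] Ctx.addX Ctx.addY Ctx.grpW Ctx.finW Ctx.actX Ctx.actY

namespace Ctx

variable (C : Ctx)

/-- The axioms of a root datum (free finite-rank lattices, perfect pairing,
finite reduced crystallographic root system with a system of positive roots),
with `W` its Weyl group acting faithfully on `X` and `Y`. -/
structure IsRootDatum : Prop where
  free_X : Module.Free ℤ C.X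
  finite_X : Module.Finite ℤ C.X
  free_Y : Module.Free ℤ C.Y
  finite_Y : Module.Finite ℤ C.Y
  perfect_left : Function.Bijective fun y : C.Y => C.pair y
  perfect_right : Function.Bijective fun x : C.X => C.pair.flip x
  pos_subset : C.pos ⊆ C.roots
  root_decomp : ∀ α ∈ C.roots, α ∈ C.pos ∨ -α ∈ C.pos
  pos_neg_disjoint : ∀ α ∈ C.pos, -α ∉ C.pos
  zero_not_root : (0 : C.X) ∉ C.roots
  reduced : ∀ α ∈ C.roots, ∀ n : ℤ, n • α ∈ C.roots → n = 1 ∨ n = -1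
  coroot_self : ∀ α ∈ C.roots, C.pair (C.coroot α) α = 2
  isReflection : ∀ α ∈ C.roots, ∃ s : C.W,
    (∀ x : C.X, s • x = x - C.pair (C.coroot α) x • α) ∧
    (∀ y : C.Y, s • y = y - C.pair y α • C.coroot α)
  weyl_gen : ∀ w : C.W, w ∈ Subgroup.closure {s : C.W | ∃ α ∈ C.roots,
    (∀ x : C.X, s • x = x - C.pair (C.coroot α) x • α) ∧
    (∀ y : C.Y, s • y = y - C.pair y α • C.coroot α)}
  faithful_X : ∀ w : C.W, (∀ x : C.X, w • x = x) → w = 1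
  faithful_Y : ∀ w : C.W, (∀ y : C.Y, w • y = y) → w = 1
  pair_inv : ∀ (w : C.W) (y : C.Y) (x : C.X), C.pair (w • y) (w • x) = C.pair y x
  roots_stable : ∀ (w : C.W), ∀ α ∈ C.roots, w • α ∈ C.roots
  smul_coroot : ∀ (w : C.W), ∀ α ∈ C.roots, w • C.coroot α = C.coroot (w • α)
  exists_regular_X : ∃ ξ : C.X, ∀ α ∈ C.pos, 0 < C.pair (C.coroot α) ξ
  exists_regular_Y : ∃ η : C.Y, ∀ α ∈ C.pos, 0 < C.pair η α

/-- The length function of the finite Weyl group: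
`ℓ(w) = #{α ∈ 𝔯₊ : w(α) ∈ −𝔯₊}`. -/
def lenW (w : C.W) : ℕ := (C.pos.filter fun α => -(w • α) ∈ C.pos).card

/-- `w` is the longest element of the finite Weyl group iff it maps every
positive root to a negative root. -/
def IsLongest (w : C.W) : Prop := ∀ α ∈ C.pos, -(w • α) ∈ C.pos

/-- The set `Y₊` of dominant cocharacters. -/
def Ypos : Set C.Y := {l | ∀ α ∈ C.pos, 0 ≤ C.pair l α}

/-- The set `Y₊₊` of strictly dominant cocharacters. -/
def Yppos : Set C.Y := {l | ∀ α ∈ C.pos, 0 < C.pair l α}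

/-- The action of `W` on `Multiplicative Y`, as a homomorphism to `MulAut`. -/
def φext : C.W →* MulAut (Multiplicative C.Y) where
  toFun w :=
    { toFun := fun y => Multiplicative.ofAdd (w • Multiplicative.toAdd y)
      invFun := fun y => Multiplicative.ofAdd (w⁻¹ • Multiplicative.toAdd y)
      left_inv := fun y => by simp
      right_inv := fun y => by simp
      map_mul' := fun a b => by simp [smul_add] }
  map_one' := by
    apply MulEquiv.ext
    intro y
    simp
  map_mul' w₁ w₂ := by
    apply MulEquiv.ext
    intro y
    simp [mul_smul]

/-- The extended affine Weyl group `W_ext = W_f ⋉ Y`. -/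
abbrev Wext : Type := Multiplicative C.Y ⋊[C.φext] C.W

/-- The translation element `t_λ ∈ W_ext` associated with `λ ∈ Y`. -/
def t (l : C.Y) : C.Wext := SemidirectProduct.inl (Multiplicative.ofAdd l)

/-- The canonical embedding of the finite Weyl group in `W_ext`. -/
def σ (w : C.W) : C.Wext := SemidirectProduct.inr w

/-- The length function on `W_ext`, defined by
`ℓ(w t_λ) = Σ_{α ∈ 𝔯₊, w(α) ∈ 𝔯₊} |⟨λ,α⟩| + Σ_{α ∈ 𝔯₊, w(α) ∈ −𝔯₊} |1 − ⟨λ,α⟩|`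
(an element `g` of the semidirect product equals `w t_λ` for `w = g.right`
and `λ = w⁻¹ • g.left`). -/
def len (g : C.Wext) : ℕ :=
  ∑ α ∈ C.pos,
    if g.right • α ∈ C.pos
      then (C.pair (g.right⁻¹ • Multiplicative.toAdd g.left) α).natAbs
      else ((1 : ℤ) - C.pair (g.right⁻¹ • Multiplicative.toAdd g.left) α).natAbs

/-- The coroot lattice `ℤ𝔯∨ ⊆ Y`. -/
def corootLattice : AddSubgroup C.Y := AddSubgroup.closure (C.coroot '' ↑C.roots)

/-- The affine Weyl group `W_aff = W_f ⋉ ℤ𝔯∨`, as a subgroup of `W_ext`. -/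
def Waff : Subgroup C.Wext :=
  Subgroup.closure ((fun l => C.t l) '' ↑C.corootLattice ∪ Set.range C.σ)

/-- The set of elements of length `1` of `W_aff` (the simple affine
reflections). -/
def Saff : Set C.Wext := {g | g ∈ C.Waff ∧ C.len g = 1}

/-- The set `Ω` of elements of length `0` of `W_ext`. -/
def OmegaSet : Set C.Wext := {g | C.len g = 0}

/-- The Bruhat order on `W_aff`: `u ≤ v` iff some reduced expression of `v`
(as a word in `S_aff`) admits a subword which is an expression of `u`. -/
def bruhatAff (u v : C.Wext) : Prop :=
  ∃ l : List C.Wext, (∀ s ∈ l, s ∈ C.Saff) ∧ l.prod = v ∧ l.length = C.len v ∧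
    ∃ l' : List C.Wext, l'.Sublist l ∧ l'.prod = u

/-- The Bruhat order on `W_ext`, extending the Bruhat order of `W_aff` by
`ω u ≤ ω' v` iff `ω = ω'` and `u ≤ v`, for `ω, ω' ∈ Ω` and `u, v ∈ W_aff`. -/
def bruhat (x y : C.Wext) : Prop :=
  ∃ ω u v : C.Wext, ω ∈ C.OmegaSet ∧ u ∈ C.Waff ∧ v ∈ C.Waff ∧
    x = ω * u ∧ y = ω * v ∧ C.bruhatAff u v

/-- The set `W_ext⁺` of `w ∈ W_ext` such that `ℓ(t_μ w) = ℓ(t_μ) + ℓ(w)` for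
every dominant `μ`. -/
def WextPlus : Set C.Wext :=
  {w | ∀ μ ∈ C.Ypos, C.len (C.t μ * w) = C.len (C.t μ) + C.len w}

/-- The semiinfinite order on `W_ext`. -/
def siLE (w y : C.Wext) : Prop :=
  ∃ μ : C.Y, C.t μ * w ∈ C.WextPlus ∧ C.t μ * y ∈ C.WextPlus ∧
    C.bruhat (C.t μ * w) (C.t μ * y)

/-- The rational vector space `ℚ ⊗ Y`. -/
abbrev QY : Type := ℚ ⊗[ℤ] C.Y

/-- The canonical map `Y → ℚ ⊗ Y`. -/
def ι : C.Y →ₗ[ℤ] C.QY := TensorProduct.mk ℤ ℚ C.Y 1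

/-- The finite set of positive coroots. -/
def posCoroots : Finset C.Y := C.pos.image C.coroot

/-- Half the sum of the positive coroots, as an element of `ℚ ⊗ Y`. -/
def rhoCheck : C.QY := (2⁻¹ : ℚ) ⊗ₜ[ℤ] (∑ β ∈ C.posCoroots, β)

/-- The set of Kostant partitions of `v ∈ ℚ ⊗ Y`: functions
`φ : 𝔯∨₊ → ℤ≥0` with `Σ_α φ(α)·α = v`. -/
def KostantSet (v : C.QY) : Set (↥C.posCoroots → ℕ) :=
  {φ | ∑ β : ↥C.posCoroots, (φ β) • C.ι (β : C.Y) = v}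

/-- Kostant's partition function. -/
def KostantP (v : C.QY) : ℕ := (C.KostantSet v).ncard

/-- The action of `w ∈ W` on `ℚ ⊗ Y`. -/
def actQ (w : C.W) : C.QY →ₗ[ℤ] C.QY :=
  LinearMap.lTensor ℚ ((DistribMulAction.toAddMonoidHom C.Y w).toIntLinearMap)

/-- The simple roots: positive roots which are not sums of two positive
roots. -/
def simpleRoots : Finset C.X :=
  C.pos.filter fun α => ¬ ∃ β ∈ C.pos, ∃ γ ∈ C.pos, α = β + γ

end Ctx

end SemiInf

namespace SemiInf

namespace Ctx

section Aux

variable {C : Ctx}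

/-- The offset of a finite root: `1` on positive roots, `0` otherwise. -/
def dl (C : Ctx) (β : C.X) : ℤ := if β ∈ C.pos then 1 else 0

/-- Positive affine roots. -/
def PA (C : Ctx) (a : C.X × ℤ) : Prop := a.1 ∈ C.roots ∧ C.dl a.1 ≤ a.2

/-- The action of `W_ext` on affine functions. -/
def act (C : Ctx) (g : C.Wext) : C.X × ℤ →+ C.X × ℤ where
  toFun a := (g.right • a.1, a.2 - C.pair (Multiplicative.toAdd g.left) (g.right • a.1))
  map_zero' := by simp
  map_add' a b := by
    ext
    · simp
    · simp; ring

/-- The finite reflection attached to a root. -/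
def refl (C : Ctx) (α : C.X) : C.W :=
  if hs : ∃ s : C.W, (∀ x : C.X, s • x = x - C.pair (C.coroot α) x • α) ∧
    (∀ y : C.Y, s • y = y - C.pair y α • C.coroot α) then hs.choose else 1

/-- The affine reflection attached to an affine root. -/
def raff (C : Ctx) (a : C.X × ℤ) : C.Wext :=
  ⟨Multiplicative.ofAdd (-(a.2 • C.coroot a.1)), C.refl a.1⟩

theorem wsmul_X (w : C.W) (n : ℤ) (x : C.X) : w • (n • x) = n • (w • x) :=
  map_zsmul (DistribSMul.toAddMonoidHom C.X w) n x

theorem wsmul_Y (w : C.W) (n : ℤ) (x : C.Y) : w • (n • x) = n • (w • x) :=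
  map_zsmul (DistribSMul.toAddMonoidHom C.Y w) n x

theorem toAdd_phi (w : C.W) (y : Multiplicative C.Y) :
    Multiplicative.toAdd ((C.φext w) y) = w • Multiplicative.toAdd y := rfl

theorem refl_X (h : C.IsRootDatum) {α : C.X} (hα : α ∈ C.roots) (x : C.X) :
    C.refl α • x = x - C.pair (C.coroot α) x • α := by
  have hs := h.isReflection α hα
  rw [refl, dif_pos hs]
  exact hs.choose_spec.1 x

theorem refl_Y (h : C.IsRootDatum) {α : C.X} (hα : α ∈ C.roots) (y : C.Y) :
    C.refl α • y = y - C.pair y α • C.coroot α := by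
  have hs := h.isReflection α hα
  rw [refl, dif_pos hs]
  exact hs.choose_spec.2 y

theorem eq_of_act_X (h : C.IsRootDatum) {u v : C.W} (huv : ∀ x : C.X, u • x = v • x) : u = v := by
  have := h.faithful_X (v⁻¹ * u) (fun x => by rw [mul_smul, huv, inv_smul_smul])
  exact (inv_mul_eq_one.mp this).symm

theorem smul_refl (h : C.IsRootDatum) (w : C.W) {α : C.X} (hα : α ∈ C.roots) :
    C.refl (w • α) * w = w * C.refl α := by
  apply eq_of_act_X h
  intro x
  rw [mul_smul, mul_smul, refl_X h (h.roots_stable w α hα), refl_X h hα, ← h.smul_coroot w α hα,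
    h.pair_inv, smul_sub, wsmul_X]

theorem refl_refl (h : C.IsRootDatum) {α : C.X} (hα : α ∈ C.roots) :
    C.refl α * C.refl α = 1 := by
  apply eq_of_act_X h
  intro x
  rw [mul_smul, refl_X h hα, refl_X h hα, one_smul, map_sub, map_zsmul, h.coroot_self α hα]
  simp only [smul_eq_mul, sub_smul, mul_smul]
  module

theorem neg_mem (h : C.IsRootDatum) {α : C.X} (hα : α ∈ C.roots) : -α ∈ C.roots := by
  have := h.roots_stable (C.refl α) α hα
  rw [refl_X h hα, h.coroot_self α hα] at this
  convert this using 1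
  module

theorem dl_neg (h : C.IsRootDatum) {α : C.X} (hα : α ∈ C.roots) :
    C.dl (-α) = 1 - C.dl α := by
  unfold dl
  by_cases h1 : α ∈ C.pos
  · simp [h1, h.pos_neg_disjoint α h1]
  · have := (h.root_decomp α hα).resolve_left h1
    simp [h1, this]

theorem PA_neg (h : C.IsRootDatum) {a : C.X × ℤ} (ha : a.1 ∈ C.roots) :
    C.PA (-a) ↔ ¬ C.PA a := by
  have := dl_neg h ha
  simp only [PA, ha, neg_mem h ha, Prod.fst_neg, Prod.snd_neg, true_and, this]
  omega

theorem act_mul (g k : C.Wext) (h : C.IsRootDatum) (a : C.X × ℤ) :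
    C.act (g * k) a = C.act g (C.act k a) := by
  have e := h.pair_inv g.right (Multiplicative.toAdd k.left) (k.right • a.1)
  ext
  · simp [act, mul_smul]
  · simp only [act, AddMonoidHom.coe_mk, ZeroHom.coe_mk, SemidirectProduct.mul_left,
      SemidirectProduct.mul_right, toAdd_mul, map_add, AddMonoidHom.add_apply, mul_smul]
    have : Multiplicative.toAdd ((C.φext g.right) k.left) = g.right • Multiplicative.toAdd k.left := rfl
    rw [this, e]
    ring

theorem act_one (a : C.X × ℤ) : C.act 1 a = a := by
  ext <;> simp [act]

theorem act_root (h : C.IsRootDatum) (g : C.Wext) {a : C.X × ℤ} (ha : a.1 ∈ C.roots) :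
    (C.act g a).1 ∈ C.roots := h.roots_stable _ _ ha

theorem act_inv_act (h : C.IsRootDatum) (g : C.Wext) (a : C.X × ℤ) :
    C.act g⁻¹ (C.act g a) = a := by
  rw [← act_mul _ _ h, inv_mul_cancel, act_one]

theorem act_act_inv (h : C.IsRootDatum) (g : C.Wext) (a : C.X × ℤ) :
    C.act g (C.act g⁻¹ a) = a := by
  rw [← act_mul _ _ h, mul_inv_cancel, act_one]

theorem root_of_act (h : C.IsRootDatum) (g : C.Wext) {a : C.X × ℤ}
    (ha : (C.act g a).1 ∈ C.roots) : a.1 ∈ C.roots := by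
  have := act_root h g⁻¹ ha
  rwa [act_inv_act h] at this

theorem act_raff (h : C.IsRootDatum) {a : C.X × ℤ} (ha : a.1 ∈ C.roots) (b : C.X × ℤ) :
    C.act (C.raff a) b = b - C.pair (C.coroot a.1) b.1 • a := by
  ext
  · exact refl_X h ha b.1
  · change b.2 - C.pair (-(a.2 • C.coroot a.1)) (C.refl a.1 • b.1) =
      b.2 - C.pair (C.coroot a.1) b.1 * a.2
    have e : C.pair (a.2 • C.coroot a.1) = a.2 • C.pair (C.coroot a.1) := map_zsmul C.pair _ _
    rw [refl_X h ha, map_neg, e, AddMonoidHom.neg_apply, AddMonoidHom.coe_smul, Pi.smul_apply,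
      map_sub, map_zsmul, h.coroot_self a.1 ha]
    simp only [smul_eq_mul]
    ring

theorem act_raff_self (h : C.IsRootDatum) {a : C.X × ℤ} (ha : a.1 ∈ C.roots) :
    C.act (C.raff a) a = -a := by
  rw [act_raff h ha, h.coroot_self a.1 ha]
  module

theorem raff_act (h : C.IsRootDatum) (g : C.Wext) {a : C.X × ℤ} (ha : a.1 ∈ C.roots) :
    C.raff (C.act g a) * g = g * C.raff a := by
  apply SemidirectProduct.ext
  · change -((a.2 - C.pair (Multiplicative.toAdd g.left) (g.right • a.1)) •
        C.coroot (g.right • a.1)) + C.refl (g.right • a.1) • (Multiplicative.toAdd g.left) =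
      Multiplicative.toAdd g.left + g.right • (-(a.2 • C.coroot a.1))
    rw [refl_Y h (h.roots_stable g.right _ ha), smul_neg, wsmul_Y, h.smul_coroot _ _ ha]
    module
  · exact smul_refl h _ ha

theorem raff_sq (h : C.IsRootDatum) {a : C.X × ℤ} (ha : a.1 ∈ C.roots) :
    C.raff a * C.raff a = 1 := by
  apply SemidirectProduct.ext
  · change -(a.2 • C.coroot a.1) + C.refl a.1 • (-(a.2 • C.coroot a.1)) = 0
    rw [smul_neg, wsmul_Y, refl_Y h ha, h.coroot_self _ ha]
    module
  · exact refl_refl h ha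

theorem raff_inv (h : C.IsRootDatum) {a : C.X × ℤ} (ha : a.1 ∈ C.roots) :
    (C.raff a)⁻¹ = C.raff a := inv_eq_of_mul_eq_one_left (raff_sq h ha)

theorem raff_neg (h : C.IsRootDatum) {a : C.X × ℤ} (ha : a.1 ∈ C.roots) :
    C.raff (-a) = C.raff a := by
  have := raff_act h (C.raff a) ha
  rw [act_raff_self h ha] at this
  exact mul_right_cancel this

theorem raff_conj (h : C.IsRootDatum) (g : C.Wext) {a : C.X × ℤ} (ha : a.1 ∈ C.roots) :
    C.raff (C.act g a) = g * C.raff a * g⁻¹ := by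
  rw [← raff_act h g ha, mul_inv_cancel_right]

/-- A height function detecting positivity of affine roots. -/
theorem exists_height (h : C.IsRootDatum) : ∃ H : C.X × ℤ →+ ℤ,
    (∀ a : C.X × ℤ, a.1 ∈ C.roots → (C.PA a ↔ 0 < H a)) ∧ 0 < H (0, 1) := by
  obtain ⟨η, hη⟩ := h.exists_regular_Y
  set M : ℤ := 1 + ∑ α ∈ C.pos, |C.pair η α| with hM
  have hM0 : ∀ α ∈ C.pos, C.pair η α < M := by
    intro α hα
    have := Finset.single_le_sum (f := fun α => |C.pair η α|) (fun i _ => abs_nonneg _) hα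
    have := le_abs_self (C.pair η α)
    omega
  have hM1 : 0 < M := by
    have := Finset.sum_nonneg (s := C.pos) (f := fun α => |C.pair η α|) (fun i _ => abs_nonneg _)
    omega
  let H : C.X × ℤ →+ ℤ :=
    { toFun := fun a => M * a.2 - C.pair η a.1
      map_zero' := by simp
      map_add' := fun a b => by simp; ring }
  have key : ∀ a : C.X × ℤ, C.PA a → 0 < H a := by
    rintro ⟨β, n⟩ ⟨hr, hn⟩
    simp only [dl] at hn hr
    change 0 < M * n - C.pair η β
    split_ifs at hn with hp
    · have := hM0 β hp
      nlinarith
    · have := hη _ ((h.root_decomp β hr).resolve_left hp)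
      rw [map_neg] at this
      nlinarith
  refine ⟨H, fun a ha => ⟨key a, fun hp => ?_⟩, ?_⟩
  · by_contra hc
    have := key _ ((PA_neg h ha).2 hc)
    rw [map_neg] at this
    omega
  · change 0 < M * 1 - C.pair η 0
    simpa using hM1


/-- The canonical invariant form on `X`. -/
def bf (C : Ctx) (x y : C.X) : ℤ :=
  ∑ γ ∈ C.roots, C.pair (C.coroot γ) x * C.pair (C.coroot γ) y

theorem bf_comm (x y : C.X) : C.bf x y = C.bf y x :=
  Finset.sum_congr rfl fun _ _ => mul_comm _ _

theorem bf_inv (h : C.IsRootDatum) (w : C.W) (x y : C.X) :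
    C.bf (w • x) (w • y) = C.bf x y := by
  unfold bf
  refine Finset.sum_nbij' (fun γ => w⁻¹ • γ) (fun γ => w • γ)
    (fun γ hγ => h.roots_stable _ _ hγ) (fun γ hγ => h.roots_stable _ _ hγ)
    (fun γ _ => smul_inv_smul _ _) (fun γ _ => inv_smul_smul _ _) (fun γ hγ => ?_)
  rw [← h.smul_coroot _ _ hγ, ← h.pair_inv w (w⁻¹ • C.coroot γ) x,
    ← h.pair_inv w (w⁻¹ • C.coroot γ) y, smul_inv_smul]

theorem bf_root (h : C.IsRootDatum) {α : C.X} (hα : α ∈ C.roots) (x : C.X) :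
    C.pair (C.coroot α) x * C.bf α α = 2 * C.bf x α := by
  have e := bf_inv h (C.refl α) x α
  rw [refl_X h hα, refl_X h hα, h.coroot_self α hα] at e
  have e2 : C.bf (x - C.pair (C.coroot α) x • α) (α - (2 : ℤ) • α) =
      - C.bf x α + C.pair (C.coroot α) x * C.bf α α := by
    unfold bf
    rw [Finset.mul_sum, ← Finset.sum_neg_distrib, ← Finset.sum_add_distrib]
    refine Finset.sum_congr rfl fun γ _ => ?_
    simp only [map_sub, map_zsmul, smul_eq_mul]
    ring
  omega

theorem bf_pos (h : C.IsRootDatum) {α : C.X} (hα : α ∈ C.roots) : 0 < C.bf α α := by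
  have := Finset.single_le_sum (s := C.roots)
    (f := fun γ => C.pair (C.coroot γ) α * C.pair (C.coroot γ) α)
    (fun i _ => mul_self_nonneg _) hα
  simp only [h.coroot_self α hα] at this
  unfold bf
  omega

theorem pair_symm_pos (h : C.IsRootDatum) {α β : C.X} (hα : α ∈ C.roots) (hβ : β ∈ C.roots)
    (hp : 0 < C.pair (C.coroot α) β) : 0 < C.pair (C.coroot β) α := by
  have e1 := bf_root h hα β
  have e2 := bf_root h hβ α
  have e3 := bf_comm α β
  have p1 := bf_pos h hα
  have p2 := bf_pos h hβ
  by_contra hc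
  nlinarith

theorem root_step (h : C.IsRootDatum) {α β : C.X} (hα : α ∈ C.roots) (hβ : β ∈ C.roots)
    (hne : β ≠ α) (hp : 0 < C.pair (C.coroot α) β) : β - α ∈ C.roots := by
  have hp' := pair_symm_pos h hα hβ hp
  have e1 := bf_root h hα β
  have e2 := bf_root h hβ α
  have e3 := bf_comm α β
  have p1 := bf_pos h hα
  have p2 := bf_pos h hβ
  by_cases k1 : C.pair (C.coroot α) β = 1
  · have := h.roots_stable (C.refl α) β hβ
    rwa [refl_X h hα, k1, one_smul] at this
  by_cases k2 : C.pair (C.coroot β) α = 1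
  · have := neg_mem h (h.roots_stable (C.refl β) α hα)
    rwa [refl_X h hβ, k2, one_smul, neg_sub] at this
  exfalso
  apply hne
  have e4 : C.bf (β - α) (β - α) = C.bf β β + C.bf α α - 2 * C.bf β α := by
    unfold bf
    rw [Finset.mul_sum, ← Finset.sum_add_distrib, ← Finset.sum_sub_distrib]
    refine Finset.sum_congr rfl fun γ _ => ?_
    simp only [map_sub]
    ring
  have e5 : C.bf (β - α) (β - α) ≤ 0 := by
    have a1 : 2 ≤ C.pair (C.coroot α) β := by omega
    have a2 : 2 ≤ C.pair (C.coroot β) α := by omega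
    nlinarith
  have e6 : ∀ γ ∈ C.roots, C.pair (C.coroot γ) (β - α) = 0 := by
    intro γ hγ
    have := Finset.single_le_sum (s := C.roots)
      (f := fun γ => C.pair (C.coroot γ) (β - α) * C.pair (C.coroot γ) (β - α))
      (fun i _ => mul_self_nonneg _) hγ
    unfold bf at e5
    have h0 := mul_self_nonneg (C.pair (C.coroot γ) (β - α))
    exact mul_self_eq_zero.mp (le_antisymm (by omega) h0)
  have e7 : C.pair (C.coroot α) β = 2 := by
    have := e6 α hα
    rw [map_sub, h.coroot_self α hα] at this
    omega
  have f1 : C.refl α • (β - α) = β - α := by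
    rw [refl_X h hα, e6 α hα, zero_smul, sub_zero]
  have f2 : C.refl β • (β - α) = β - α := by
    rw [refl_X h hβ, e6 β hβ, zero_smul, sub_zero]
  have f3 : (C.refl α * C.refl β) • β = β - (2 : ℤ) • (β - α) := by
    rw [mul_smul, refl_X h hβ, h.coroot_self β hβ, refl_X h hα]
    simp only [map_sub, map_zsmul, e7]
    module
  have f4 : ∀ n : ℕ, (C.refl α * C.refl β) ^ n • β = β - (2 * n : ℤ) • (β - α) := by
    intro n
    induction n with
    | zero => simp
    | succ n ih =>
      rw [pow_succ', mul_smul, ih, smul_sub, f3, wsmul_X, mul_smul (C.refl α), f2, f1]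
      push_cast
      module
  have f5 := f4 (orderOf (C.refl α * C.refl β))
  have f6 : 0 < orderOf (C.refl α * C.refl β) := orderOf_pos _
  rw [pow_orderOf_eq_one, one_smul] at f5
  set n := orderOf (C.refl α * C.refl β)
  have f7 : (2 * n : ℤ) • (β - α) = 0 := by
    have := sub_eq_self.mp f5.symm
    exact this
  have f8 : ∀ y, C.pair y (β - α) = 0 := by
    intro y
    have := congrArg (C.pair y) f7
    rw [map_zsmul, map_zero, smul_eq_mul] at this
    rcases mul_eq_zero.mp this with h1 | h1
    · omega
    · exact h1
  have f9 : β - α = 0 := by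
    apply h.perfect_right.1
    ext y
    simpa using f8 y
  exact sub_eq_zero.mp f9

/-- Simple affine roots. -/
def Simp (C : Ctx) (a : C.X × ℤ) : Prop :=
  C.PA a ∧ ∀ b, C.PA b → b ≠ a → C.PA (C.act (C.raff a) b)

theorem simp_of_indec (h : C.IsRootDatum) {a : C.X × ℤ} (ha : C.PA a)
    (h1 : ∀ b c, C.PA b → C.PA c → a ≠ b + c) (h2 : ∀ m < a.2, ¬ C.PA (a.1, m)) : C.Simp a := by
  obtain ⟨H, hH, -⟩ := exists_height h
  refine ⟨ha, ?_⟩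
  have key : ∀ k : ℕ, ∀ b, C.PA b → b ≠ a → C.pair (C.coroot a.1) b.1 ≤ k →
      C.PA (C.act (C.raff a) b) := by
    intro k
    induction k using Nat.strong_induction_on with
    | _ k ih =>
    intro b hb hne hk
    have hrb : (C.act (C.raff a) b).1 ∈ C.roots := act_root h _ hb.1
    by_contra hn
    have hc : C.PA (-(C.act (C.raff a) b)) := (PA_neg h hrb).2 hn
    by_cases heq : b.1 = a.1
    · have hm : b.2 ≠ a.2 := fun e => hne (Prod.ext heq e)
      rcases lt_or_gt_of_ne hm with hlt | hlt
      · apply h2 _ hlt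
        rw [← heq]
        exact hb
      · apply h2 (2 * a.2 - b.2) (by omega)
        convert hc using 1
        rw [act_raff h ha.1, heq, h.coroot_self _ ha.1]
        ext
        · simp only [Prod.fst_neg, Prod.fst_sub, Prod.smul_fst, heq]
          module
        · simp
    by_cases hp : C.pair (C.coroot a.1) b.1 ≤ 0
    · apply hn
      rw [hH _ hrb, act_raff h ha.1, map_sub, map_zsmul, smul_eq_mul]
      have := (hH _ ha.1).1 ha
      have := (hH _ hb.1).1 hb
      nlinarith
    have hst : (b - a).1 ∈ C.roots := root_step h ha.1 hb.1 heq (by omega)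
    by_cases hba : C.PA (b - a)
    · have h3 : C.PA (C.act (C.raff a) (b - a)) := by
        have e : C.pair (C.coroot a.1) (b - a).1 = C.pair (C.coroot a.1) b.1 - 2 := by
          rw [Prod.fst_sub, map_sub, h.coroot_self _ ha.1]
        apply ih (k - 1) (by omega) _ hba
        · intro e
          have e' : b.1 = (2 : ℤ) • a.1 := by
            have := congrArg Prod.fst (sub_eq_iff_eq_add.mp e)
            rw [this]
            simp only [Prod.fst_add]
            module
          have := h.reduced a.1 ha.1 2 (e' ▸ hb.1)
          omega
        · omega
      apply h1 _ _ hc h3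
      rw [map_sub, act_raff_self h ha.1]
      abel
    · have := (PA_neg h hst).2 hba
      apply h1 _ _ hb this
      abel
  intro b hb hne
  exact key (C.pair (C.coroot a.1) b.1).toNat b hb hne (Int.self_le_toNat _)

theorem exists_descent (h : C.IsRootDatum) (g : C.Wext)
    (hg : ∃ a, C.PA a ∧ ¬ C.PA (C.act g a)) : ∃ a, C.Simp a ∧ ¬ C.PA (C.act g a) := by
  obtain ⟨H, hH, hd⟩ := exists_height h
  obtain ⟨a, ha, hga⟩ := hg
  have key : ∀ k : ℕ, ∀ a, C.PA a → ¬ C.PA (C.act g a) → H a ≤ k →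
      ∃ a, C.Simp a ∧ ¬ C.PA (C.act g a) := by
    intro k
    induction k using Nat.strong_induction_on with
    | _ k ih =>
    intro a ha hga hk
    have hpa := (hH _ ha.1).1 ha
    by_cases h1 : ∀ b c, C.PA b → C.PA c → a ≠ b + c
    · by_cases h2 : ∀ m < a.2, ¬ C.PA (a.1, m)
      · exact ⟨a, simp_of_indec h ha h1 h2, hga⟩
      · push Not at h2
        obtain ⟨m, hm, hP⟩ := h2
        have e : a = (a.1, m) + (a.2 - m) • ((0, 1) : C.X × ℤ) := by
          ext <;> simp
        have e2 : H a = H (a.1, m) + (a.2 - m) * H (0, 1) := by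
          conv_lhs => rw [e]
          rw [map_add, map_zsmul, smul_eq_mul]
        have e3 : 0 < (a.2 - m) * H (0, 1) := mul_pos (by omega) hd
        apply ih (k - 1) (by omega) _ hP
        · intro hc
          apply hga
          refine ⟨hc.1, hc.2.trans ?_⟩
          simp only [act, AddMonoidHom.coe_mk, ZeroHom.coe_mk]
          omega
        · have := (hH _ hP.1).1 hP
          omega
    · push Not at h1
      obtain ⟨b, c, hb, hc, e⟩ := h1
      have pb := (hH _ hb.1).1 hb
      have pc := (hH _ hc.1).1 hc
      have e2 : H a = H b + H c := by rw [e, map_add]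
      by_cases hgb : C.PA (C.act g b)
      · apply ih (k - 1) (by omega) c hc _ (by omega)
        intro hgc
        apply hga
        rw [hH _ (act_root h g ha.1), e, map_add, map_add]
        have := (hH _ hgb.1).1 hgb
        have := (hH _ hgc.1).1 hgc
        omega
      · exact ih (k - 1) (by omega) b hb hgb (by omega)
  exact key (H a).toNat a ha hga (Int.self_le_toNat _)


/-- The finite set of inversions of `g`. -/
def Nf (C : Ctx) (g : C.Wext) : Finset (C.X × ℤ) :=
  (C.roots.sigma fun β => Finset.Ico (C.dl β)
    (C.pair (Multiplicative.toAdd g.left) (g.right • β) + C.dl (g.right • β))).image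
    fun p => (p.1, p.2)

theorem mem_Nf (h : C.IsRootDatum) (g : C.Wext) (a : C.X × ℤ) :
    a ∈ C.Nf g ↔ C.PA a ∧ ¬ C.PA (C.act g a) := by
  obtain ⟨β, n⟩ := a
  simp only [Nf, Finset.mem_image, Finset.mem_sigma, Finset.mem_Ico, PA, act, AddMonoidHom.coe_mk,
    ZeroHom.coe_mk]
  constructor
  · rintro ⟨⟨b, m⟩, ⟨h1, h2, h3⟩, e⟩
    simp only [Prod.mk.injEq] at e h1 h2 h3
    obtain ⟨rfl, rfl⟩ := e
    exact ⟨⟨h1, h2⟩, fun hc => by omega⟩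
  · rintro ⟨⟨h1, h2⟩, h3⟩
    refine ⟨⟨β, n⟩, ⟨h1, h2, ?_⟩, rfl⟩
    have := h.roots_stable g.right β h1
    simp only [this, true_and] at h3
    simp only
    omega

theorem card_Nf (g : C.Wext) : (C.Nf g).card = ∑ β ∈ C.roots,
    (C.pair (Multiplicative.toAdd g.left) (g.right • β) + C.dl (g.right • β) - C.dl β).toNat := by
  rw [Nf, Finset.card_image_of_injective, Finset.card_sigma]
  · simp
  · rintro ⟨a, b⟩ ⟨c, d⟩ e
    simp only [Prod.mk.injEq] at e
    obtain ⟨rfl, rfl⟩ := e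
    rfl

theorem sum_roots (h : C.IsRootDatum) (f : C.X → ℕ) :
    ∑ β ∈ C.roots, f β = ∑ α ∈ C.pos, (f α + f (-α)) := by
  have e : C.roots = C.pos ∪ C.pos.image (fun x => -x) := by
    ext x
    simp only [Finset.mem_union, Finset.mem_image]
    constructor
    · intro hx
      rcases h.root_decomp x hx with h1 | h1
      · exact Or.inl h1
      · exact Or.inr ⟨-x, h1, neg_neg x⟩
    · rintro (h1 | ⟨y, h1, rfl⟩)
      · exact h.pos_subset h1
      · exact neg_mem h (h.pos_subset h1)
  have hd : Disjoint C.pos (C.pos.image (fun x => -x)) := by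
    rw [Finset.disjoint_left]
    intro x hx hx2
    obtain ⟨y, hy, rfl⟩ := Finset.mem_image.1 hx2
    exact h.pos_neg_disjoint y hy hx
  rw [e, Finset.sum_union hd, Finset.sum_image (fun x _ y _ e => neg_injective e),
    Finset.sum_add_distrib]

theorem len_eq (h : C.IsRootDatum) (g : C.Wext) : C.len g = (C.Nf g).card := by
  rw [card_Nf, sum_roots h, len]
  refine Finset.sum_congr rfl fun α hα => ?_
  have hr := h.pos_subset hα
  have e : C.pair (g.right⁻¹ • Multiplicative.toAdd g.left) α =
      C.pair (Multiplicative.toAdd g.left) (g.right • α) := by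
    rw [← h.pair_inv g.right, smul_inv_smul]
  rw [e, smul_neg, dl_neg h hr, dl_neg h (h.roots_stable g.right α hr), map_neg]
  generalize C.pair (Multiplicative.toAdd g.left) (g.right • α) = m
  have e1 : C.dl α = 1 := by simp [dl, hα]
  rw [e1]
  unfold dl
  split_ifs <;> omega

theorem len_of_dominant (h : C.IsRootDatum) (g : C.Wext)
    (hg : Multiplicative.toAdd g.left ∈ C.Ypos) :
    (C.len g : ℤ) = ∑ α ∈ C.pos, C.pair (Multiplicative.toAdd g.left) α +
      ∑ α ∈ C.pos, (1 - C.dl (g.right⁻¹ • α)) := by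
  have e : C.len g = ∑ γ ∈ C.roots, (C.pair (Multiplicative.toAdd g.left) γ + C.dl γ -
      C.dl (g.right⁻¹ • γ)).toNat := by
    rw [len_eq h, card_Nf]
    refine Finset.sum_nbij' (fun γ => g.right • γ) (fun γ => g.right⁻¹ • γ)
      (fun γ hγ => h.roots_stable _ _ hγ) (fun γ hγ => h.roots_stable _ _ hγ)
      (fun γ _ => inv_smul_smul _ _) (fun γ _ => smul_inv_smul _ _) (fun γ hγ => ?_)
    rw [inv_smul_smul]
  rw [e, sum_roots h, ← Finset.sum_add_distrib]
  push_cast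
  refine Finset.sum_congr rfl fun α hα => ?_
  have hr := h.pos_subset hα
  have e1 : C.dl α = 1 := by simp [dl, hα]
  have hp := hg α hα
  rw [smul_neg, dl_neg h hr, dl_neg h (h.roots_stable _ α hr), map_neg, e1]
  unfold dl
  split_ifs <;> omega

theorem t_mul_left (μ : C.Y) (g : C.Wext) :
    Multiplicative.toAdd (C.t μ * g).left = μ + Multiplicative.toAdd g.left := by
  simp [t]

theorem t_mul_right (μ : C.Y) (g : C.Wext) : (C.t μ * g).right = g.right := by
  simp [t]

theorem t_add (μ ν : C.Y) : C.t (μ + ν) = C.t μ * C.t ν := by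
  simp [t]

theorem t_neg (μ : C.Y) : C.t (-μ) = (C.t μ)⁻¹ := by
  rw [eq_inv_iff_mul_eq_one, ← t_add, neg_add_cancel]
  rfl

theorem len_t (h : C.IsRootDatum) {μ : C.Y} (hμ : μ ∈ C.Ypos) :
    (C.len (C.t μ) : ℤ) = ∑ α ∈ C.pos, C.pair μ α := by
  have e := len_of_dominant h (C.t μ) hμ
  rw [e]
  have : ∑ α ∈ C.pos, (1 - C.dl ((C.t μ).right⁻¹ • α)) = 0 := by
    apply Finset.sum_eq_zero
    intro α hα
    have : (C.t μ).right = 1 := rfl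
    rw [this]
    simp [dl, hα]
  rw [this, add_zero]
  rfl

theorem Ypos_add {μ ν : C.Y} (hμ : μ ∈ C.Ypos) (hν : ν ∈ C.Ypos) : μ + ν ∈ C.Ypos := by
  intro α hα
  have := hμ α hα
  have := hν α hα
  rw [map_add, AddMonoidHom.add_apply]
  omega

theorem plus_of_dominant (h : C.IsRootDatum) (g : C.Wext)
    (hg : Multiplicative.toAdd g.left ∈ C.Ypos) : g ∈ C.WextPlus := by
  intro μ hμ
  have e1 := len_of_dominant h g hg
  have e2 := len_of_dominant h (C.t μ * g) (by rw [t_mul_left]; exact Ypos_add hμ hg)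
  have e3 := len_t h hμ
  rw [t_mul_left, t_mul_right] at e2
  simp only [map_add, AddMonoidHom.add_apply, Finset.sum_add_distrib] at e2
  omega

theorem plus_t_mul (h : C.IsRootDatum) {g : C.Wext} (hg : g ∈ C.WextPlus) {ν : C.Y}
    (hν : ν ∈ C.Ypos) : C.t ν * g ∈ C.WextPlus := by
  intro μ hμ
  have e1 := hg _ (Ypos_add hμ hν)
  have e2 := hg _ hν
  have e3 := len_t h hμ
  have e4 := len_t h hν
  have e5 := len_t h (Ypos_add hμ hν)
  simp only [map_add, AddMonoidHom.add_apply, Finset.sum_add_distrib] at e5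
  rw [t_add, mul_assoc, ← t_add] at e1
  omega

theorem exists_dominant (h : C.IsRootDatum) (l : C.Y) :
    ∃ ν ∈ C.Ypos, ν + l ∈ C.Ypos := by
  obtain ⟨η, hη⟩ := h.exists_regular_Y
  set M : ℤ := ∑ α ∈ C.pos, |C.pair l α| with hM
  have hM0 : ∀ α ∈ C.pos, -C.pair l α ≤ M := by
    intro α hα
    have := Finset.single_le_sum (f := fun α => |C.pair l α|) (fun i _ => abs_nonneg _) hα
    have := neg_le_abs (C.pair l α)
    omega
  have hM1 : 0 ≤ M := Finset.sum_nonneg (fun i _ => abs_nonneg _)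
  have e : ∀ α, C.pair (M • η) α = M * C.pair η α := by
    intro α
    have := map_zsmul C.pair M η
    rw [this]
    rfl
  refine ⟨M • η, fun α hα => ?_, fun α hα => ?_⟩
  · rw [e]
    exact mul_nonneg hM1 (hη α hα).le
  · rw [map_add, AddMonoidHom.add_apply, e]
    have := hη α hα
    have := hM0 α hα
    nlinarith

theorem common_shift (h : C.IsRootDatum) (μ μ' : C.Y) :
    ∃ ν ∈ C.Ypos, ∃ ν' ∈ C.Ypos, ν + μ = ν' + μ' := by
  obtain ⟨ν, h1, h2⟩ := exists_dominant h (μ - μ')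
  exact ⟨ν, h1, ν + (μ - μ'), h2, by abel⟩

/-! ### Length and reflections -/

theorem act_injective (h : C.IsRootDatum) (g : C.Wext) : Function.Injective (C.act g) :=
  Function.LeftInverse.injective (act_inv_act h g)

theorem act_neg (g : C.Wext) (a : C.X × ℤ) : C.act g (-a) = -(C.act g a) := map_neg _ _

theorem len_inv (h : C.IsRootDatum) (g : C.Wext) : C.len g⁻¹ = C.len g := by
  rw [len_eq h, len_eq h]
  have : C.Nf g⁻¹ = (C.Nf g).image (fun a => -(C.act g a)) := by
    ext b
    rw [mem_Nf h, Finset.mem_image]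
    constructor
    · rintro ⟨h1, h2⟩
      refine ⟨-(C.act g⁻¹ b), ?_, ?_⟩
      · rw [mem_Nf h, PA_neg h (act_root h _ h1.1)]
        refine ⟨h2, ?_⟩
        rw [act_neg, act_act_inv h, PA_neg h h1.1]
        exact not_not_intro h1
      · rw [act_neg, act_act_inv h, neg_neg]
    · rintro ⟨a, ha, rfl⟩
      rw [mem_Nf h] at ha
      rw [PA_neg h (act_root h _ ha.1.1), act_neg, act_inv_act h, PA_neg h ha.1.1]
      exact ⟨ha.2, not_not_intro ha.1⟩
  rw [this, Finset.card_image_of_injective]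
  exact neg_injective.comp (act_injective h g)

theorem omega_PA (h : C.IsRootDatum) {ω : C.Wext} (hω : C.len ω = 0) {a : C.X × ℤ}
    (ha : a.1 ∈ C.roots) : C.PA (C.act ω a) ↔ C.PA a := by
  have key : ∀ b, C.PA b → C.PA (C.act ω b) := by
    intro b hb
    by_contra hc
    have := (mem_Nf h ω b).2 ⟨hb, hc⟩
    rw [len_eq h, Finset.card_eq_zero] at hω
    simp [hω] at this
  refine ⟨fun hp => ?_, key a⟩
  by_contra hc
  have := key _ ((PA_neg h ha).2 hc)
  rw [act_neg, PA_neg h (act_root h _ ha)] at this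
  exact this hp

theorem len_omega_mul (h : C.IsRootDatum) {ω : C.Wext} (hω : C.len ω = 0) (g : C.Wext) :
    C.len (ω * g) = C.len g := by
  rw [len_eq h, len_eq h]
  congr 1
  ext a
  rw [mem_Nf h, mem_Nf h, act_mul _ _ h]
  refine and_congr_right fun ha => ?_
  rw [omega_PA h hω (act_root h _ ha.1)]

theorem len_mul_simp (h : C.IsRootDatum) {a : C.X × ℤ} (ha : C.Simp a) (g : C.Wext)
    (hg : C.PA (C.act g a)) : C.len (g * C.raff a) = C.len g + 1 := by
  have har := ha.1.1
  have hinv : ∀ b, C.act (C.raff a) (C.act (C.raff a) b) = b := by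
    intro b
    rw [← act_mul _ _ h, raff_sq h har, act_one]
  have hgna : ¬ C.PA (-(C.act g a)) := by
    rw [PA_neg h (act_root h _ har)]
    exact not_not_intro hg
  have hna : ¬ C.PA (-a) := by
    rw [PA_neg h har]
    exact not_not_intro ha.1
  have : C.Nf (g * C.raff a) = insert a ((C.Nf g).image (C.act (C.raff a))) := by
    ext b
    rw [mem_Nf h, Finset.mem_insert, Finset.mem_image, act_mul _ _ h]
    constructor
    · rintro ⟨h1, h2⟩
      by_cases hb : b = a
      · exact Or.inl hb
      · exact Or.inr ⟨C.act (C.raff a) b, (mem_Nf h _ _).2 ⟨ha.2 b h1 hb, h2⟩, hinv b⟩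
    · rintro (rfl | ⟨c, hc, rfl⟩)
      · refine ⟨ha.1, ?_⟩
        rwa [act_raff_self h har, act_neg]
      · rw [mem_Nf h] at hc
        rw [hinv]
        refine ⟨ha.2 c hc.1 ?_, hc.2⟩
        rintro rfl
        exact hc.2 hg
  rw [len_eq h, len_eq h, this, Finset.card_insert_of_notMem,
    Finset.card_image_of_injective _ (act_injective h _)]
  rw [Finset.mem_image]
  rintro ⟨c, hc, e⟩
  rw [mem_Nf h] at hc
  have e2 : c = -a := by rw [← hinv c, e, act_raff_self h har]
  exact hna (e2 ▸ hc.1)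

theorem len_mul_simp' (h : C.IsRootDatum) {a : C.X × ℤ} (ha : C.Simp a) (g : C.Wext)
    (hg : ¬ C.PA (C.act g a)) : C.len (g * C.raff a) + 1 = C.len g := by
  have har := ha.1.1
  have := len_mul_simp h ha (g * C.raff a) (by
    rw [act_mul _ _ h, act_raff_self h har, act_neg, PA_neg h (act_root h _ har)]
    exact hg)
  rw [mul_assoc, raff_sq h har, mul_one] at this
  exact this.symm

theorem len_one (h : C.IsRootDatum) : C.len 1 = 0 := by
  rw [len_eq h, Finset.card_eq_zero, Finset.eq_empty_iff_forall_notMem]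
  intro a ha
  rw [mem_Nf h, act_one] at ha
  exact ha.2 ha.1

theorem len_simp (h : C.IsRootDatum) {a : C.X × ℤ} (ha : C.Simp a) : C.len (C.raff a) = 1 := by
  have := len_mul_simp h ha 1 (by rw [act_one]; exact ha.1)
  rwa [one_mul, len_one h] at this

theorem descent_of_len (h : C.IsRootDatum) {g : C.Wext} (hg : C.len g ≠ 0) :
    ∃ a, C.Simp a ∧ ¬ C.PA (C.act g a) := by
  apply exists_descent h
  rw [len_eq h, Ne, Finset.card_eq_zero, ← Ne, ← Finset.nonempty_iff_ne_empty] at hg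
  obtain ⟨a, ha⟩ := hg
  exact ⟨a, (mem_Nf h g a).1 ha⟩


/-! ### Words in simple reflections -/

/-- Words in simple affine reflections. -/
def SW (C : Ctx) (l : List C.Wext) : Prop := ∀ s ∈ l, ∃ a, C.Simp a ∧ s = C.raff a

theorem SW.sublist {l l' : List C.Wext} (hl : C.SW l) (hs : l'.Sublist l) : C.SW l' :=
  fun s h1 => hl s (hs.subset h1)

theorem SW.tail {s : C.Wext} {l : List C.Wext} (hl : C.SW (s :: l)) : C.SW l :=
  fun s h1 => hl s (List.mem_cons_of_mem _ h1)

theorem len_simp_mul_le (h : C.IsRootDatum) {a : C.X × ℤ} (ha : C.Simp a) (g : C.Wext) :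
    C.len (C.raff a * g) ≤ C.len g + 1 := by
  rw [← len_inv h, mul_inv_rev, raff_inv h ha.1.1, ← len_inv h g]
  by_cases hp : C.PA (C.act g⁻¹ a)
  · rw [len_mul_simp h ha _ hp]
  · have := len_mul_simp' h ha _ hp
    omega

theorem len_word_mul (h : C.IsRootDatum) (l : List C.Wext) (hl : C.SW l) (g : C.Wext) :
    C.len (l.prod * g) ≤ l.length + C.len g := by
  induction l with
  | nil => simp
  | cons s l ih =>
    obtain ⟨a, ha, rfl⟩ := hl s (List.mem_cons_self)
    have := ih hl.tail
    have := len_simp_mul_le h ha (l.prod * g)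
    rw [List.prod_cons, mul_assoc, List.length_cons]
    omega

theorem len_word (h : C.IsRootDatum) (l : List C.Wext) (hl : C.SW l) :
    C.len l.prod ≤ l.length := by
  have := len_word_mul h l hl 1
  rwa [mul_one, len_one h] at this

theorem exchange (h : C.IsRootDatum) (l : List C.Wext) (hl : C.SW l) {a : C.X × ℤ} (ha : C.PA a)
    (hn : ¬ C.PA (C.act l.prod a)) :
    ∃ l' : List C.Wext, l'.Sublist l ∧ l'.length + 1 = l.length ∧ l'.prod = l.prod * C.raff a := by
  induction l with
  | nil =>
    rw [List.prod_nil, act_one] at hn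
    exact absurd ha hn
  | cons s l ih =>
    obtain ⟨c, hc, rfl⟩ := hl s (List.mem_cons_self)
    by_cases hp : C.PA (C.act l.prod a)
    · have e : C.act l.prod a = c := by
        by_contra hne
        apply hn
        rw [List.prod_cons, act_mul _ _ h]
        exact hc.2 _ hp hne
      refine ⟨l, List.sublist_cons_self _ _, rfl, ?_⟩
      have := raff_act h l.prod ha.1
      rw [e] at this
      rw [List.prod_cons, mul_assoc, ← this, ← mul_assoc, raff_sq h hc.1.1, one_mul]
    · obtain ⟨l', h1, h2, h3⟩ := ih hl.tail hp
      refine ⟨C.raff c :: l', h1.cons_cons _, by simp [h2], ?_⟩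
      rw [List.prod_cons, List.prod_cons, h3, mul_assoc]

theorem reduce (h : C.IsRootDatum) (l : List C.Wext) (hl : C.SW l) :
    ∃ l' : List C.Wext, l'.Sublist l ∧ l'.length = C.len l.prod ∧ l'.prod = l.prod := by
  induction l using List.reverseRecOn with
  | nil => exact ⟨[], List.Sublist.refl _, by simp [len_one h], rfl⟩
  | append_singleton l s ih =>
    have hl1 : C.SW l := hl.sublist (List.sublist_append_left _ _)
    obtain ⟨m, h1, h2, h3⟩ := ih hl1
    obtain ⟨a, ha, rfl⟩ := hl s (by simp)
    have hm := hl1.sublist h1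
    rw [List.prod_append, List.prod_singleton]
    by_cases hp : C.PA (C.act l.prod a)
    · refine ⟨m ++ [C.raff a], h1.append (List.Sublist.refl _), ?_, ?_⟩
      · rw [len_mul_simp h ha _ hp, List.length_append, h2]
        rfl
      · rw [List.prod_append, h3, List.prod_singleton]
    · obtain ⟨m', k1, k2, k3⟩ := exchange h m hm ha.1 (by rwa [h3])
      refine ⟨m', (k1.trans h1).trans (List.sublist_append_left _ _), ?_, ?_⟩
      · have := len_mul_simp' h ha _ hp
        omega
      · rw [k3, h3]

theorem exists_word (h : C.IsRootDatum) (g : C.Wext) : ∃ (ω : C.Wext) (l : List C.Wext),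
    C.len ω = 0 ∧ C.SW l ∧ l.length = C.len g ∧ g = ω * l.prod := by
  generalize hn : C.len g = n
  induction n generalizing g with
  | zero => exact ⟨g, [], hn, by simp [SW], rfl, by simp⟩
  | succ n ih =>
    obtain ⟨a, ha, hp⟩ := descent_of_len h (g := g) (by omega)
    have := len_mul_simp' h ha g hp
    obtain ⟨ω, l, h1, h2, h3, h4⟩ := ih (g * C.raff a) (by omega)
    refine ⟨ω, l ++ [C.raff a], h1, ?_, by simp [h3], ?_⟩
    · intro s hs
      rcases List.mem_append.1 hs with h5 | h5
      · exact h2 s h5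
      · exact ⟨a, ha, List.mem_singleton.1 h5⟩
    · rw [List.prod_append, List.prod_singleton, ← mul_assoc, ← h4, mul_assoc, raff_sq h ha.1.1,
        mul_one]

/-! ### The reflection order -/

/-- Elementary relation of the Bruhat order. -/
def Edge (C : Ctx) (u v : C.Wext) : Prop :=
  ∃ a, C.PA a ∧ C.PA (C.act u a) ∧ v = u * C.raff a

/-- The Bruhat order generated by reflections. -/
def Ch (C : Ctx) : C.Wext → C.Wext → Prop := Relation.ReflTransGen C.Edge

theorem edge_not (h : C.IsRootDatum) {u : C.Wext} {a : C.X × ℤ} (ha : C.PA a)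
    (hu : C.PA (C.act u a)) : ¬ C.PA (C.act (u * C.raff a) a) := by
  rw [act_mul _ _ h, act_raff_self h ha.1, act_neg, PA_neg h hu.1]
  exact not_not_intro hu

theorem edge_len (h : C.IsRootDatum) {u v : C.Wext} (e : C.Edge u v) : C.len u < C.len v := by
  obtain ⟨a, ha, hu, rfl⟩ := e
  have hn := edge_not h ha hu
  obtain ⟨ω, l, h1, h2, h3, h4⟩ := exists_word h (u * C.raff a)
  rw [h4, act_mul _ _ h, omega_PA h h1 (act_root h _ ha.1)] at hn
  obtain ⟨l', k1, k2, k3⟩ := exchange h l h2 ha hn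
  have e : u = ω * l'.prod := by
    rw [k3, ← mul_assoc, ← h4, mul_assoc, raff_sq h ha.1, mul_one]
  have e2 : C.len u = C.len l'.prod := by
    conv_lhs => rw [e]
    exact len_omega_mul h h1 _
  have := len_word h l' (h2.sublist k1)
  omega

theorem ch_len (h : C.IsRootDatum) {u v : C.Wext} (e : C.Ch u v) :
    u = v ∨ C.len u < C.len v := by
  induction e with
  | refl => exact Or.inl rfl
  | tail _ e2 ih =>
    have := edge_len h e2
    rcases ih with rfl | ih
    · exact Or.inr this
    · exact Or.inr (by omega)

theorem ch_antisymm (h : C.IsRootDatum) {u v : C.Wext} (e : C.Ch u v) (e' : C.Ch v u) : u = v := by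
  rcases ch_len h e with h1 | h1
  · exact h1
  · rcases ch_len h e' with h2 | h2
    · exact h2.symm
    · omega

theorem ch_omega (h : C.IsRootDatum) {ω : C.Wext} (hω : C.len ω = 0) {u v : C.Wext}
    (e : C.Ch u v) : C.Ch (ω * u) (ω * v) := by
  refine Relation.ReflTransGen.lift (r := C.Edge) (p := C.Edge) (fun x => ω * x) ?_ _ _ e
  rintro x y ⟨a, ha, hx, rfl⟩
  refine ⟨a, ha, ?_, by rw [mul_assoc]⟩
  rw [act_mul _ _ h, omega_PA h hω hx.1]
  exact hx

theorem ch_left (h : C.IsRootDatum) {a : C.X × ℤ} (ha : C.Simp a) {u v : C.Wext} (e : C.Ch u v) :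
    C.Ch (C.raff a * u) (C.raff a * v) ∨ C.Ch (C.raff a * u) v := by
  induction e using Relation.ReflTransGen.head_induction_on with
  | refl => exact Or.inl Relation.ReflTransGen.refl
  | head e1 e2 ih =>
    rename_i x y
    obtain ⟨b, hb, hx, rfl⟩ := e1
    by_cases hp : C.act x b = a
    · right
      have := raff_act h x hb.1
      rw [hp] at this
      rw [this]
      exact e2
    · have ed : C.Edge (C.raff a * x) (C.raff a * (x * C.raff b)) := by
        refine ⟨b, hb, ?_, by rw [mul_assoc]⟩
        rw [act_mul _ _ h]
        exact ha.2 _ hx hp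
      rcases ih with ih | ih
      · exact Or.inl (Relation.ReflTransGen.head ed ih)
      · exact Or.inr (Relation.ReflTransGen.head ed ih)

theorem left_up (h : C.IsRootDatum) {a : C.X × ℤ} (ha : C.Simp a) {v : C.Wext}
    (hv : C.len v < C.len (C.raff a * v)) : C.Edge v (C.raff a * v) := by
  have hp : C.PA (C.act v⁻¹ a) := by
    by_contra hc
    have := len_mul_simp' h ha _ hc
    rw [← len_inv h (v⁻¹ * C.raff a), mul_inv_rev, raff_inv h ha.1.1, inv_inv, len_inv h] at this
    omega
  refine ⟨_, hp, ?_, ?_⟩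
  · rw [act_act_inv h]
    exact ha.1
  · have := raff_act h v hp.1
    rw [act_act_inv h] at this
    exact this

theorem ch_left_up (h : C.IsRootDatum) {a : C.X × ℤ} (ha : C.Simp a) {u v : C.Wext}
    (e : C.Ch u v) (hv : C.len v < C.len (C.raff a * v)) :
    C.Ch (C.raff a * u) (C.raff a * v) := by
  rcases ch_left h ha e with h1 | h1
  · exact h1
  · exact h1.tail (left_up h ha hv)

theorem ch_left_word (h : C.IsRootDatum) (l : List C.Wext) (hl : C.SW l) {u v : C.Wext}
    (e : C.Ch u v) (hv : C.len (l.prod * v) = l.length + C.len v) :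
    C.Ch (l.prod * u) (l.prod * v) := by
  induction l with
  | nil => simpa using e
  | cons s l ih =>
    obtain ⟨a, ha, rfl⟩ := hl s (List.mem_cons_self)
    rw [List.prod_cons, mul_assoc, List.length_cons] at hv
    have h1 := len_word_mul h l hl.tail v
    have h2 := len_simp_mul_le h ha (l.prod * v)
    rw [List.prod_cons, mul_assoc, mul_assoc]
    exact ch_left_up h ha (ih hl.tail (by omega)) (by omega)

theorem sub_ch (h : C.IsRootDatum) {l l' : List C.Wext} (hs : l'.Sublist l) (hl : C.SW l)
    (hr : l.length = C.len l.prod) : C.Ch l'.prod l.prod := by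
  induction hs with
  | slnil => exact Relation.ReflTransGen.refl
  | @cons l1 l2 s hs ih =>
    obtain ⟨a, ha, rfl⟩ := hl s (List.mem_cons_self)
    rw [List.prod_cons, List.length_cons] at hr
    have h1 := len_word h l2 hl.tail
    have h2 := len_simp_mul_le h ha l2.prod
    rw [List.prod_cons]
    exact (ih hl.tail (by omega)).tail (left_up h ha (by omega))
  | @cons_cons l1 l2 s hs ih =>
    obtain ⟨a, ha, rfl⟩ := hl s (List.mem_cons_self)
    rw [List.prod_cons, List.length_cons] at hr
    have h1 := len_word h l2 hl.tail
    have h2 := len_simp_mul_le h ha l2.prod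
    rw [List.prod_cons, List.prod_cons]
    exact ch_left_up h ha (ih hl.tail (by omega)) (by omega)

theorem ch_sub (h : C.IsRootDatum) {l : List C.Wext} (hl : C.SW l) {u v : C.Wext}
    (hv : v = l.prod) (e : C.Ch u v) : ∃ l' : List C.Wext, l'.Sublist l ∧ l'.prod = u := by
  induction e using Relation.ReflTransGen.head_induction_on with
  | refl => exact ⟨l, List.Sublist.refl _, hv.symm⟩
  | head e1 e2 ih =>
    obtain ⟨m, h1, h2⟩ := ih
    obtain ⟨a, ha, hx, rfl⟩ := e1
    have hn := edge_not h ha hx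
    rw [← h2] at hn
    obtain ⟨m', k1, k2, k3⟩ := exchange h m (hl.sublist h1) ha hn
    refine ⟨m', k1.trans h1, ?_⟩
    rw [k3, h2, mul_assoc, raff_sq h ha.1, mul_one]

/-! ### The affine Weyl group -/

/-- The subgroup generated by simple affine reflections. -/
def Wsim (C : Ctx) : Subgroup C.Wext := Subgroup.closure {s | ∃ a, C.Simp a ∧ s = C.raff a}

theorem word_of_mem (h : C.IsRootDatum) {x : C.Wext} (hx : x ∈ C.Wsim) :
    ∃ l, C.SW l ∧ l.prod = x := by
  induction hx using Subgroup.closure_induction with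
  | mem x hx => exact ⟨[x], fun s hs => by rwa [List.mem_singleton.1 hs], by simp⟩
  | one => exact ⟨[], by simp [SW], rfl⟩
  | mul x y _ _ hx hy =>
    obtain ⟨l, h1, h2⟩ := hx
    obtain ⟨m, h3, h4⟩ := hy
    refine ⟨l ++ m, fun s hs => ?_, by rw [List.prod_append, h2, h4]⟩
    rcases List.mem_append.1 hs with h5 | h5
    · exact h1 s h5
    · exact h3 s h5
  | inv x _ hx =>
    obtain ⟨l, h1, h2⟩ := hx
    refine ⟨(l.map fun x => x⁻¹).reverse, fun s hs => ?_, by rw [← h2, List.prod_inv_reverse]⟩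
    obtain ⟨r, hr, rfl⟩ := List.mem_map.1 (List.mem_reverse.1 hs)
    obtain ⟨a, ha, rfl⟩ := h1 r hr
    exact ⟨a, ha, raff_inv h ha.1.1⟩

theorem raff_mem_of_PA (h : C.IsRootDatum) {a : C.X × ℤ} (ha : C.PA a) : C.raff a ∈ C.Wsim := by
  obtain ⟨H, hH, hd⟩ := exists_height h
  have key : ∀ k : ℕ, ∀ a, C.PA a → H a ≤ k → C.raff a ∈ C.Wsim := by
    intro k
    induction k using Nat.strong_induction_on with
    | _ k ih =>
    intro a ha hk
    have hpa := (hH _ ha.1).1 ha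
    obtain ⟨b, hb, hn⟩ := exists_descent h (C.raff a) ⟨a, ha, by
      rw [act_raff_self h ha.1, PA_neg h ha.1]; exact not_not_intro ha⟩
    have hbm : C.raff b ∈ C.Wsim := Subgroup.subset_closure ⟨b, hb, rfl⟩
    by_cases hab : a = b
    · rw [hab]
      exact hbm
    have hpb := (hH _ hb.1.1).1 hb.1
    have h1 : 0 < C.pair (C.coroot a.1) b.1 := by
      by_contra hc
      apply hn
      rw [hH _ (act_root h _ hb.1.1), act_raff h ha.1, map_sub, map_zsmul, smul_eq_mul]
      nlinarith
    have h2 := pair_symm_pos h ha.1 hb.1.1 h1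
    have h3 := hb.2 a ha hab
    have h4 : H (C.act (C.raff b) a) < H a := by
      rw [act_raff h hb.1.1, map_sub, map_zsmul, smul_eq_mul]
      nlinarith
    have h5 := (hH _ h3.1).1 h3
    have h6 := ih (k - 1) (by omega) _ h3 (by omega)
    rw [raff_conj h _ ha.1] at h6
    have h7 := C.Wsim.mul_mem (C.Wsim.mul_mem (C.Wsim.inv_mem hbm) h6) hbm
    simpa [mul_assoc] using h7
  exact key (H a).toNat a ha (Int.self_le_toNat _)

theorem raff_mem (h : C.IsRootDatum) {a : C.X × ℤ} (ha : a.1 ∈ C.roots) : C.raff a ∈ C.Wsim := by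
  by_cases hp : C.PA a
  · exact raff_mem_of_PA h hp
  · rw [← raff_neg h ha]
    exact raff_mem_of_PA h ((PA_neg h ha).2 hp)

theorem Waff_le (h : C.IsRootDatum) : C.Waff ≤ C.Wsim := by
  unfold Waff
  rw [Subgroup.closure_le]
  rintro x (⟨l, hl, rfl⟩ | ⟨w, rfl⟩)
  · change C.t l ∈ C.Wsim
    have hl' : l ∈ AddSubgroup.closure (C.coroot '' ↑C.roots) := hl
    induction hl' using AddSubgroup.closure_induction with
    | mem x hx =>
      obtain ⟨β, hβ, rfl⟩ := hx
      have hβ : β ∈ C.roots := hβ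
      have e : C.t (C.coroot β) = C.raff (β, -1) * C.raff (β, 0) := by
        apply SemidirectProduct.ext
        · change C.coroot β = -((-1 : ℤ) • C.coroot β) +
            C.refl β • (-((0 : ℤ) • C.coroot β))
          simp
        · exact (refl_refl h hβ).symm
      rw [e]
      exact C.Wsim.mul_mem (raff_mem h hβ) (raff_mem h hβ)
    | zero => exact C.Wsim.one_mem
    | add x y hx hy h1 h2 =>
      rw [t_add]
      exact C.Wsim.mul_mem (h1 hx) (h2 hy)
    | neg x hx h1 =>
      rw [t_neg]
      exact C.Wsim.inv_mem (h1 hx)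
  · change C.σ w ∈ C.Wsim
    have hw := h.weyl_gen w
    induction hw using Subgroup.closure_induction with
    | mem s hs =>
      obtain ⟨α, hα, h1, h2⟩ := hs
      have e : s = C.refl α := eq_of_act_X h (fun x => by rw [h1, refl_X h hα])
      have e2 : C.σ s = C.raff (α, 0) := by
        apply SemidirectProduct.ext
        · change (0 : C.Y) = -((0 : ℤ) • C.coroot α)
          simp
        · exact e
      rw [e2]
      exact raff_mem h hα
    | one => exact C.Wsim.one_mem
    | mul x y _ _ h1 h2 =>
      have : C.σ (x * y) = C.σ x * C.σ y := map_mul SemidirectProduct.inr x y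
      rw [this]
      exact C.Wsim.mul_mem h1 h2
    | inv x _ h1 =>
      have : C.σ x⁻¹ = (C.σ x)⁻¹ := map_inv SemidirectProduct.inr x
      rw [this]
      exact C.Wsim.inv_mem h1

theorem raff_mem_Waff {a : C.X × ℤ} (ha : a.1 ∈ C.roots) : C.raff a ∈ C.Waff := by
  have e : C.raff a = C.t (-(a.2 • C.coroot a.1)) * C.σ (C.refl a.1) :=
    SemidirectProduct.mk_eq_inl_mul_inr _ _
  rw [e]
  refine C.Waff.mul_mem (Subgroup.subset_closure (Or.inl ⟨_, ?_, rfl⟩))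
    (Subgroup.subset_closure (Or.inr ⟨_, rfl⟩))
  have hc : C.coroot a.1 ∈ C.corootLattice := AddSubgroup.subset_closure ⟨a.1, ha, rfl⟩
  exact C.corootLattice.neg_mem (C.corootLattice.zsmul_mem hc _)

theorem Wsim_omega (h : C.IsRootDatum) {x : C.Wext} (hx : x ∈ C.Wsim) (h0 : C.len x = 0) :
    x = 1 := by
  obtain ⟨l, h1, rfl⟩ := word_of_mem h hx
  obtain ⟨l', -, h3, h4⟩ := reduce h l h1
  rw [h0, List.length_eq_zero_iff] at h3
  rw [← h4, h3, List.prod_nil]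

theorem mem_Saff (h : C.IsRootDatum) (s : C.Wext) :
    s ∈ C.Saff ↔ ∃ a, C.Simp a ∧ s = C.raff a := by
  constructor
  · rintro ⟨h1, h2⟩
    obtain ⟨a, ha, hn⟩ := descent_of_len h (g := s) (by omega)
    refine ⟨a, ha, ?_⟩
    have h3 := len_mul_simp' h ha s hn
    have h4 := Wsim_omega h (C.Wsim.mul_mem (Waff_le h h1) (raff_mem h ha.1.1)) (by omega)
    rw [← raff_inv h ha.1.1]
    exact eq_inv_of_mul_eq_one_left h4
  · rintro ⟨a, ha, rfl⟩
    exact ⟨raff_mem_Waff ha.1.1, len_simp h ha⟩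

theorem SW_mem_Waff {l : List C.Wext} (hl : C.SW l) : l.prod ∈ C.Waff := by
  apply Subgroup.list_prod_mem
  intro s hs
  obtain ⟨a, ha, rfl⟩ := hl s hs
  exact raff_mem_Waff ha.1.1

theorem bruhat_iff (h : C.IsRootDatum) (x y : C.Wext) : C.bruhat x y ↔ C.Ch x y := by
  constructor
  · rintro ⟨ω, u, v, hω, -, -, rfl, rfl, l, h1, rfl, h3, l', h4, rfl⟩
    exact ch_omega h hω (sub_ch h h4 (fun s hs => (mem_Saff h s).1 (h1 s hs)) h3)
  · intro e
    obtain ⟨ω, l, h1, h2, h3, h4⟩ := exists_word h y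
    have e2 := ch_omega h (ω := ω⁻¹) (by rw [len_inv h, h1]) e
    obtain ⟨l', h5, h6⟩ := ch_sub h h2 (by rw [h4, inv_mul_cancel_left]) e2
    refine ⟨ω, l'.prod, l.prod, h1, SW_mem_Waff (h2.sublist h5), SW_mem_Waff h2,
      by rw [h6, mul_inv_cancel_left], h4, l, fun s hs => (mem_Saff h s).2 (h2 s hs), rfl, ?_,
      l', h5, rfl⟩
    rw [h3, h4, len_omega_mul h h1]

theorem ch_t (h : C.IsRootDatum) {x y : C.Wext} (e : C.Ch x y) (hy : y ∈ C.WextPlus) {ν : C.Y}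
    (hν : ν ∈ C.Ypos) : C.Ch (C.t ν * x) (C.t ν * y) := by
  obtain ⟨ω, l, h1, h2, h3, h4⟩ := exists_word h (C.t ν)
  have h5 := hy ν hν
  rw [← h3, h4, mul_assoc, len_omega_mul h h1] at h5
  rw [h4, mul_assoc, mul_assoc]
  exact ch_omega h h1 (ch_left_word h l h2 e h5)

/-- Two semiinfinite relations can be witnessed by a common shift. -/
theorem siLE_common (h : C.IsRootDatum) {w y w' y' : C.Wext} (e : C.siLE w y)
    (e' : C.siLE w' y') : ∃ μ, (C.t μ * w ∈ C.WextPlus ∧ C.t μ * y ∈ C.WextPlus ∧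
      C.Ch (C.t μ * w) (C.t μ * y)) ∧ (C.t μ * w' ∈ C.WextPlus ∧ C.t μ * y' ∈ C.WextPlus ∧
      C.Ch (C.t μ * w') (C.t μ * y')) := by
  obtain ⟨μ, a1, a2, a3⟩ := e
  obtain ⟨μ', b1, b2, b3⟩ := e'
  obtain ⟨ν, hν, ν', hν', hc⟩ := common_shift h μ μ'
  rw [bruhat_iff h] at a3 b3
  refine ⟨ν + μ, ?_, ?_⟩
  · rw [t_add, mul_assoc, mul_assoc]
    exact ⟨plus_t_mul h a1 hν, plus_t_mul h a2 hν, ch_t h a3 a2 hν⟩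
  · rw [hc, t_add, mul_assoc, mul_assoc]
    exact ⟨plus_t_mul h b1 hν', plus_t_mul h b2 hν', ch_t h b3 b2 hν'⟩

end Aux

end Ctx

end SemiInf

/-- The semiinfinite order is a partial order on `W_ext`:
reflexive, antisymmetric and transitive. -/
theorem statement9 (C : SemiInf.Ctx) (h : C.IsRootDatum) :
    (∀ w : C.Wext, C.siLE w w) ∧
    (∀ w y : C.Wext, C.siLE w y → C.siLE y w → w = y) ∧
    (∀ w y z : C.Wext, C.siLE w y → C.siLE y z → C.siLE w z) := by
  refine ⟨fun w => ?_, fun w y h1 h2 => ?_, fun w y z h1 h2 => ?_⟩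
  · obtain ⟨ν, h1, h2⟩ := SemiInf.Ctx.exists_dominant h (Multiplicative.toAdd w.left)
    have h3 : C.t ν * w ∈ C.WextPlus :=
      SemiInf.Ctx.plus_of_dominant h _ (by rw [SemiInf.Ctx.t_mul_left]; exact h2)
    exact ⟨ν, h3, h3, (SemiInf.Ctx.bruhat_iff h _ _).2 Relation.ReflTransGen.refl⟩
  · obtain ⟨μ, ⟨-, -, a3⟩, -, -, b3⟩ := SemiInf.Ctx.siLE_common h h1 h2
    exact mul_left_cancel (SemiInf.Ctx.ch_antisymm h a3 b3)
  · obtain ⟨μ, ⟨a1, a2, a3⟩, b1, b2, b3⟩ := SemiInf.Ctx.siLE_common h h1 h2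
    exact ⟨μ, a1, b2, (SemiInf.Ctx.bruhat_iff h _ _).2 (Relation.ReflTransGen.trans a3 b3)⟩
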